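/- arXiv:math/0102127 — 2 statements merged into one kernel-verified Lean document; each statement's English description precedes it below -/
import Mathlib

section
/- Let U be a vector space and f(x,y) ∈ U[[x, x^{-1}, y, y^{-1}]]. Then (x-y)^{k+1} f(x,y) = 0 for some nonnegative integer k if and only if f(x,y) = Σ_{i=0}^{k} f_i(y) Δ^(i)(x,y) for some f_0(y), …, f_k(y) ∈ U[[y, y^{-1}]]. -/
/-- Doubly infinite formal series `Σ_{m,n} a(m,n) x^m y^n` with coefficients in `U`,
represented by the coefficient function `(m, n) ↦ a(m,n)`. -/
abbrev FS (U : Type*) := ℤ → ℤ → U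

section Defs

variable {U : Type*} [AddCommGroup U] [Module ℂ U]

/-- Formal partial derivative `∂/∂x`. -/
def dX (f : FS U) : FS U := fun m n => (m + 1) • f (m + 1) n

/-- Formal partial derivative `∂/∂y`. -/
def dY (f : FS U) : FS U := fun m n => (n + 1) • f m (n + 1)

/-- Multiplication by `(x - y)`. -/
def xmy (f : FS U) : FS U := fun m n => f (m - 1) n - f m (n - 1)

/-- `Δ(x,y) = y⁻¹ δ(x/y) = Σ_{m ∈ ℤ} x^m y^{-m-1}`. -/
def Delta0 : FS ℂ := fun m n => if n = -m - 1 then 1 else 0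

/-- `Δ^(k)(x,y) = (∂/∂x)^k (y⁻¹ δ(x/y))`. -/
noncomputable def Dk (k : ℕ) : FS ℂ := dX^[k] Delta0

/-- The product `f(y) · g(x,y)` of a series `f(y) = Σ_j f_j y^j` in `y` alone with a
series `g ∈ ℂ[[x,x⁻¹,y,y⁻¹]]`; well defined (as a genuinely finite sum) whenever each
coefficient of `x^m` in `g` is a monomial in `y`, as is the case for `g = Δ^(k)`. -/
noncomputable def ymul (f : ℤ → U) (g : FS ℂ) : FS U :=
  fun m n => ∑ᶠ j : ℤ, g m (n - j) • f j

/-- The product `f(x) · g(x,y)` of a series `f(x)` in `x` alone with `g`. -/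
noncomputable def xmul (f : ℤ → ℂ) (g : FS ℂ) : FS ℂ :=
  fun m n => ∑ᶠ j : ℤ, f j * g (m - j) n

/-- Formal derivative of a one-variable series `Σ_j f_j y^j`. -/
noncomputable def fder (f : ℤ → ℂ) : ℤ → ℂ := fun j => (j + 1) • f (j + 1)

end Defs

section Helpers

variable {U : Type*} [AddCommGroup U] [Module ℂ U]

/-- The coefficient `(m+1)(m+2)⋯(m+i)`. -/
def cc : ℕ → ℤ → ℂ
  | 0, _ => 1
  | i + 1, m => ((m : ℂ) + 1) * cc i (m + 1)

theorem cc_succ_right (i : ℕ) : ∀ m : ℤ, cc (i + 1) m = cc i m * ((m : ℂ) + i + 1) := by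
  induction i with
  | zero => intro m; simp [cc]
  | succ i ih =>
    intro m
    rw [cc, ih (m + 1), cc]
    push_cast
    ring

theorem cc_diff (i : ℕ) (m : ℤ) : cc (i + 1) (m - 1) - cc (i + 1) m = -((i : ℂ) + 1) * cc i m := by
  rw [cc_succ_right i m, cc]
  push_cast
  rw [sub_add_cancel m 1]
  ring

theorem Dk_apply (i : ℕ) : ∀ m n : ℤ, Dk i m n = if n = -(m + i) - 1 then cc i m else 0 := by
  induction i with
  | zero => intro m n; simp [Dk, Delta0, cc]
  | succ i ih =>
    intro m n
    have h : Dk (i + 1) = dX (Dk i) := by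
      simp only [Dk, Function.iterate_succ_apply']
    rw [h, dX, ih]
    have e : (n = -(m + 1 + (i : ℤ)) - 1) ↔ (n = -(m + ((i + 1 : ℕ) : ℤ)) - 1) := by
      push_cast; constructor <;> intro h <;> linarith
    simp only [e, cc]
    split_ifs <;> simp

theorem ymul_apply (g : ℤ → U) (i : ℕ) (m n : ℤ) :
    ymul g (Dk i) m n = cc i m • g (n + m + i + 1) := by
  rw [ymul, finsum_eq_single _ (n + m + i + 1)]
  · rw [Dk_apply, if_pos (by ring)]
  · intro j hj
    rw [Dk_apply, if_neg, zero_smul]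
    intro h
    apply hj
    linarith

/-- `xmy` as an additive map. -/
def xmyHom : FS U →+ FS U where
  toFun := xmy
  map_zero' := by funext m n; simp [xmy]
  map_add' f g := by funext m n; simp [xmy]; abel

theorem xmyHom_apply (f : FS U) : xmyHom f = xmy f := rfl

theorem xmy_ymul_zero (g : ℤ → U) : xmy (ymul g (Dk 0)) = 0 := by
  funext m n
  simp only [xmy, ymul_apply, cc, one_smul, Pi.zero_apply]
  rw [sub_eq_zero]
  congr 1
  ring

theorem xmy_ymul_succ (g : ℤ → U) (i : ℕ) :
    xmy (ymul g (Dk (i + 1))) = ymul (fun j => (-((i : ℂ) + 1)) • g j) (Dk i) := by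
  funext m n
  simp only [xmy, ymul_apply]
  have e1 : n + (m - 1) + ((i + 1 : ℕ) : ℤ) + 1 = n + m + i + 1 := by push_cast; ring
  have e2 : n - 1 + m + ((i + 1 : ℕ) : ℤ) + 1 = n + m + i + 1 := by push_cast; ring
  rw [e1, e2, ← sub_smul, cc_diff, smul_smul, mul_comm]

theorem xmy_eq_zero (f : FS U) (h : xmy f = 0) : ∃ g : ℤ → U, f = ymul g (Dk 0) := by
  have step : ∀ m n : ℤ, f (m + 1) n = f m (n + 1) := by
    intro m n
    have := congrFun (congrFun h (m + 1)) (n + 1)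
    simp only [xmy, Pi.zero_apply, add_sub_cancel_right] at this
    exact (sub_eq_zero.mp this).symm
  have key : ∀ m n : ℤ, f m n = f 0 (n + m) := by
    intro m
    induction m using Int.induction_on with
    | zero => intro n; simp
    | succ i ih => intro n; rw [step, ih]; congr 1; ring
    | pred i ih =>
      intro n
      have := step (-(i : ℤ) - 1) (n - 1)
      rw [sub_add_cancel, sub_add_cancel] at this
      rw [← this, ih]; congr 1; ring
  refine ⟨fun s => f 0 (s - 1), ?_⟩
  funext m n
  rw [ymul_apply, cc, one_smul, key]
  congr 1
  push_cast
  ring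

theorem main_aux (k : ℕ) : ∀ f : FS U, xmy^[k] f = 0 ↔
      ∃ g : ℕ → (ℤ → U), f = ∑ i ∈ Finset.range k, ymul (g i) (Dk i) := by
  induction k with
  | zero => intro f; simp
  | succ k ih =>
    intro f
    rw [Function.iterate_succ_apply, ih]
    constructor
    · rintro ⟨g, hg⟩
      let g' : ℕ → ℤ → U := fun i j => (-((i : ℂ) + 1))⁻¹ • g i j
      have hh : xmy (f - ∑ i ∈ Finset.range k, ymul (g' i) (Dk (i + 1))) = 0 := by
        rw [← xmyHom_apply, map_sub, map_sum, xmyHom_apply, hg, sub_eq_zero]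
        refine Finset.sum_congr rfl fun i _ => ?_
        rw [xmyHom_apply, xmy_ymul_succ]
        congr 1
        funext j
        have : (-((i : ℂ) + 1)) ≠ 0 := neg_ne_zero.mpr (Nat.cast_add_one_ne_zero i)
        simp only [g']
        rw [smul_inv_smul₀ this]
      obtain ⟨g0, h0⟩ := xmy_eq_zero _ hh
      refine ⟨fun i => Nat.casesOn i g0 g', ?_⟩
      rw [Finset.sum_range_succ']
      exact (sub_eq_iff_eq_add'.mp h0)
    · rintro ⟨g, rfl⟩
      refine ⟨fun i j => (-((i : ℂ) + 1)) • g (i + 1) j, ?_⟩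
      rw [← xmyHom_apply, map_sum, Finset.sum_range_succ', xmyHom_apply (ymul (g 0) (Dk 0)),
        xmy_ymul_zero, add_zero]
      refine Finset.sum_congr rfl fun i _ => ?_
      rw [xmyHom_apply, xmy_ymul_succ]

end Helpers

/-- `(x-y)^{k+1} f(x,y) = 0` iff
`f(x,y) = Σ_{i=0}^k f_i(y) Δ^(i)(x,y)` for some series `f_i(y)`. -/
theorem stmt5 {U : Type*} [AddCommGroup U] [Module ℂ U] (k : ℕ) (f : FS U) :
    xmy^[k + 1] f = 0 ↔
      ∃ g : ℕ → (ℤ → U), f = ∑ i ∈ Finset.range (k + 1), ymul (g i) (Dk i) :=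
  main_aux (k + 1) f
end

section
/- Let V be a vertex algebra. Define a * b = a_{-1} b for a, b ∈ V. Then [a, b] := a*b − b*a = a_{-1}b − b_{-1}a defines a Lie algebra structure on V (i.e. V with product * is Lie admissible). -/
/-- Integer binomial coefficient `binom(p, i)` for `p ∈ ℤ`, `i ∈ ℕ`. -/
def zchoose (p : ℤ) (i : ℕ) : ℤ :=
  if 0 ≤ p then (p.toNat.choose i : ℤ) else (-1) ^ i * (((i : ℤ) - 1 - p).toNat.choose i : ℤ)

/-- A vertex algebra `(V, Y, 1)` over `ℂ`: the datum of bilinear products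
`(a, b) ↦ aₙb = (Y n) a b` for `n ∈ ℤ` (the coefficients of the vertex operator
`Y(a,x)b = Σₙ aₙb x^{-n-1}`), a vacuum vector `vac = 1`, subject to truncation,
the vacuum property `Y(1,x) = id`, the creation property
`Y(a,x)1 ∈ V[[x]]`, `lim_{x→0} Y(a,x)1 = a`, and the Borcherds (Jacobi) identity. -/
structure VertexAlgebra (V : Type*) [AddCommGroup V] [Module ℂ V] where
  Y : ℤ → V →ₗ[ℂ] V →ₗ[ℂ] V
  vac : V
  trunc : ∀ a b : V, ∃ N : ℤ, ∀ n ≥ N, Y n a b = 0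
  vacuum : ∀ (n : ℤ) (b : V), Y n vac b = if n = -1 then b else 0
  creation_nonneg : ∀ (a : V) (n : ℤ), 0 ≤ n → Y n a vac = 0
  creation : ∀ a : V, Y (-1) a vac = a
  borcherds : ∀ (a b c : V) (p q r : ℤ),
    (∑ᶠ i : ℕ, zchoose p i • Y (p + q - i) (Y (r + i) a b) c) =
    ∑ᶠ i : ℕ, ((-1 : ℤ) ^ i * zchoose r i) •
      (Y (p + r - i) a (Y (q + i) b c)
        - (r.negOnePow : ℤ) • Y (q + r - i) b (Y (p + i) a c))

theorem quasi_assoc {V : Type*} [AddCommGroup V] [Module ℂ V] (W : VertexAlgebra V)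
    (c : V) : ∃ G : V → V → V, ∀ a b : V,
      W.Y (-1) (W.Y (-1) a b) c = W.Y (-1) a (W.Y (-1) b c) + (G a b + G b a) := by
  refine ⟨fun a b => ∑ᶠ i : ℕ, W.Y (-2 - (i : ℤ)) a (W.Y i b c), fun a b => ?_⟩
  obtain ⟨N1, h1⟩ := W.trunc a c
  obtain ⟨N2, h2⟩ := W.trunc b c
  obtain ⟨N, hN1, hN2⟩ : ∃ N : ℕ, N1 ≤ N ∧ N2 ≤ N :=
    ⟨(max N1 N2).toNat, by omega, by omega⟩
  have hz : ∀ i : ℕ, (-1 : ℤ) ^ i * zchoose (-1) i = 1 := by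
    intro i
    have : ((i : ℤ) - 1 - (-1)).toNat = i := by omega
    rw [zchoose, if_neg (by norm_num), this, Nat.choose_self, Nat.cast_one, mul_one, ← mul_pow]
    simp
  have hB := W.borcherds a b c 0 (-1) (-1)
  rw [finsum_eq_single _ 0 (by
    intro i hi
    have : zchoose 0 i = 0 := by
      obtain ⟨j, rfl⟩ := Nat.exists_eq_succ_of_ne_zero hi
      simp [zchoose]
    rw [this, zero_smul])] at hB
  have h0 : zchoose 0 0 = 1 := by simp [zchoose]
  have hn : (((-1 : ℤ).negOnePow : ℤˣ) : ℤ) = -1 := by simp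
  simp only [hz, one_smul, h0, hn, neg_smul, sub_neg_eq_add] at hB
  have e1 : (0 + -1 - ((0 : ℕ) : ℤ)) = -1 := by norm_num
  have e2 : (-1 + ((0 : ℕ) : ℤ)) = -1 := by norm_num
  rw [e1, e2] at hB
  rw [hB]
  beta_reduce
  have key : ∀ (f : ℕ → V) (M : ℕ), (∀ i, M ≤ i → f i = 0) →
      ∑ᶠ i, f i = ∑ i ∈ Finset.range M, f i := by
    intro f M hf
    apply finsum_eq_sum_of_support_subset
    intro i hi
    by_contra hc
    exact hi (hf i (by simpa using hc))
  rw [key _ (N + 1), key _ N, key _ N, Finset.sum_add_distrib, Finset.sum_range_succ',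
    Finset.sum_range_succ (fun i : ℕ => W.Y (-1 + -1 - (i : ℤ)) b (W.Y (0 + (i : ℤ)) a c))]
  · have e3 : W.Y (0 + (N : ℤ)) a c = 0 := h1 _ (by omega)
    rw [e3, map_zero, add_zero, e1, e2]
    have s1 : ∀ i : ℕ, (-1 - ((i + 1 : ℕ) : ℤ)) = -2 - i := by intro i; push_cast; ring
    have s2 : ∀ i : ℕ, (-1 + ((i + 1 : ℕ) : ℤ)) = i := by intro i; push_cast; ring
    have s3 : ∀ i : ℕ, (-1 + -1 - (i : ℤ)) = -2 - i := by intro i; ring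
    simp only [s1, s2, s3, zero_add]
    abel
  all_goals
    intro i hi
    simp only [h1 (i : ℤ) (by omega), h1 (0 + (i : ℤ)) (by omega), h2 (i : ℤ) (by omega),
      map_zero, add_zero]
  rw [h2 _ (by omega), map_zero]

/-- in a vertex algebra `V`, the commutator
`[a,b] = a*b - b*a = a₋₁b - b₋₁a` of the product `a*b = a₋₁b` defines a Lie algebra
structure on `V` (so `(V,*)` is Lie admissible): the bracket is skew-symmetric and
satisfies the Jacobi identity. -/
theorem stmt12 {V : Type*} [AddCommGroup V] [Module ℂ V] (W : VertexAlgebra V)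
    (br : V → V → V) (hbr : ∀ a b : V, br a b = W.Y (-1) a b - W.Y (-1) b a) :
    (∀ a b : V, br a b = - br b a) ∧
    (∀ a b c : V, br (br a b) c + br (br b c) a + br (br c a) b = 0) := by
  refine ⟨fun a b => by rw [hbr, hbr]; abel, fun a b c => ?_⟩
  obtain ⟨Ga, ha⟩ := quasi_assoc W a
  obtain ⟨Gb, hb⟩ := quasi_assoc W b
  obtain ⟨Gc, hc⟩ := quasi_assoc W c
  simp only [hbr, map_sub, LinearMap.sub_apply]
  rw [hc a b, hc b a, ha b c, ha c b, hb c a, hb a c]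
  abel
end
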